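/- (Remark 1: finite sticky particle systems) Let N ≥ 1, let m_1, …, m_N > 0 be masses, and let x̄_1, …, x̄_N ∈ ℝⁿ and v̄_1, …, v̄_N ∈ ℝⁿ be initial positions and velocities. Then there exists a unique sticky solution x_1, …, x_N : [0,∞) → ℝⁿ of the sticky particle system with data (m_i, x̄_i, v̄_i), defined for all t ≥ 0. -/

import Mathlib

open Set

/-- The common velocity, at time `s`, of the cluster of particles occupying the same
position as the `i`-th particle: the total momentum of the cluster divided by its total
mass, where `J_i(s) = {j : x_j(s) = x_i(s)}`. -/
noncomputable def stickyVel {ι : Type*} {n : ℕ} (m : ι → ℝ)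
    (vInit : ι → EuclideanSpace ℝ (Fin n)) (x : ι → ℝ → EuclideanSpace ℝ (Fin n))
    (i : ι) (s : ℝ) : EuclideanSpace ℝ (Fin n) :=
  (∑' j : {j : ι // x j s = x i s}, m (j : ι))⁻¹ •
    ∑' j : {j : ι // x j s = x i s}, m (j : ι) • vInit (j : ι)

/-- A family of continuous maps `x_i : [0,∞) → ℝⁿ` is a weak solution of the sticky
particle system with masses `m_i`, initial positions `x̄_i` and initial velocities `v̄_i`
if `x_i(0) = x̄_i` and `x_i(t) = x̄_i + ∫₀ᵗ V_i(s) ds` for all `t ≥ 0`. -/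
def IsWeakSolution {ι : Type*} {n : ℕ} (m : ι → ℝ)
    (xInit vInit : ι → EuclideanSpace ℝ (Fin n))
    (x : ι → ℝ → EuclideanSpace ℝ (Fin n)) : Prop :=
  (∀ i, ContinuousOn (x i) (Ici (0 : ℝ))) ∧ (∀ i, x i 0 = xInit i) ∧
    ∀ i, ∀ t : ℝ, 0 ≤ t → x i t = xInit i + ∫ s in (0 : ℝ)..t, stickyVel m vInit x i s

/-- A weak solution is a sticky solution if particles occupying the same position at some
time `t₀ ≥ 0` occupy the same position for all later times. -/
def IsStickySolution {ι : Type*} {n : ℕ} (m : ι → ℝ)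
    (xInit vInit : ι → EuclideanSpace ℝ (Fin n))
    (x : ι → ℝ → EuclideanSpace ℝ (Fin n)) : Prop :=
  IsWeakSolution m xInit vInit x ∧
    ∀ i j, ∀ t₀ : ℝ, 0 ≤ t₀ → x i t₀ = x j t₀ → ∀ t, t₀ ≤ t → x i t = x j t

open Topology Filter MeasureTheory

/-- Velocity of a configuration. -/
noncomputable def cfgVel {ι : Type*} {n : ℕ} (m : ι → ℝ)
    (v : ι → EuclideanSpace ℝ (Fin n)) (p : ι → EuclideanSpace ℝ (Fin n)) (i : ι) :
    EuclideanSpace ℝ (Fin n) :=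
  stickyVel m v (fun j _ => p j) i 0

lemma stickyVel_eq_cfg {ι : Type*} {n : ℕ} (m : ι → ℝ)
    (v : ι → EuclideanSpace ℝ (Fin n)) (x : ι → ℝ → EuclideanSpace ℝ (Fin n)) (i : ι) (s : ℝ) :
    stickyVel m v x i s = cfgVel m v (fun j => x j s) i := rfl

open Classical in
lemma cfgVel_eq {N n : ℕ} (m : Fin N → ℝ)
    (v p : Fin N → EuclideanSpace ℝ (Fin n)) (i : Fin N) :
    cfgVel m v p i = (∑ j, if p j = p i then m j else 0)⁻¹ •
      ∑ j, if p j = p i then m j • v j else 0 := by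
  unfold cfgVel stickyVel
  rw [tsum_fintype, tsum_fintype, ← Finset.sum_filter, ← Finset.sum_filter]
  congr 1
  · congr 1
    exact (Finset.sum_subtype _ (by simp) _).symm
  · exact (Finset.sum_subtype _ (by simp) (fun j => m j • v j)).symm

lemma cfgVel_congr {N n : ℕ} (m : Fin N → ℝ)
    (v p q : Fin N → EuclideanSpace ℝ (Fin n)) (i k : Fin N)
    (h : ∀ j, p j = p i ↔ q j = q k) : cfgVel m v p i = cfgVel m v q k := by
  classical
  simp only [cfgVel_eq, h]

lemma cfgVel_bdd {N n : ℕ} (m : Fin N → ℝ) (v : Fin N → EuclideanSpace ℝ (Fin n)) :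
    ∃ C, ∀ p i, ‖cfgVel m v p i‖ ≤ C := by
  classical
  refine ⟨∑ S : Finset (Fin N), ‖(∑ j ∈ S, m j)⁻¹ • ∑ j ∈ S, m j • v j‖, fun p i => ?_⟩
  rw [cfgVel_eq, ← Finset.sum_filter, ← Finset.sum_filter]
  exact Finset.single_le_sum
    (f := fun S : Finset (Fin N) => ‖(∑ j ∈ S, m j)⁻¹ • ∑ j ∈ S, m j • v j‖)
    (fun _ _ => norm_nonneg _) (Finset.mem_univ _)

lemma stickyVel_integrable {N n : ℕ} (m : Fin N → ℝ) (v : Fin N → EuclideanSpace ℝ (Fin n))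
    (x : Fin N → ℝ → EuclideanSpace ℝ (Fin n)) (hx : ∀ i, ContinuousOn (x i) (Ici 0))
    (i : Fin N) (a b : ℝ) (ha : 0 ≤ a) (hb : 0 ≤ b) :
    IntervalIntegrable (stickyVel m v x i) volume a b := by
  classical
  set z : Fin N → ℝ → EuclideanSpace ℝ (Fin n) := fun i s => x i (max s 0) with hz
  have hzc : ∀ i, Continuous (z i) := fun i =>
    (hx i).comp_continuous (by fun_prop) (fun s => mem_Ici.2 (le_max_right _ _))
  have hms : ∀ i j, MeasurableSet {s | z i s = z j s} := fun i j =>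
    (isClosed_eq (hzc i) (hzc j)).measurableSet
  have hmeas : Measurable (stickyVel m v z i) := by
    have : stickyVel m v z i = fun s => (∑ j, if z j s = z i s then m j else 0)⁻¹ •
      ∑ j, if z j s = z i s then m j • v j else 0 := by
      funext s; rw [stickyVel_eq_cfg, cfgVel_eq]
    rw [this]
    have h1 : Measurable fun s => ∑ j, if z j s = z i s then m j else 0 :=
      Finset.measurable_sum _ fun j _ =>
        Measurable.ite (hms j i) measurable_const measurable_const
    have h2 : Measurable fun s => ∑ j, if z j s = z i s then m j • v j else 0 :=
      Finset.measurable_sum _ fun j _ =>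
        Measurable.ite (hms j i) measurable_const measurable_const
    exact h1.inv.smul h2
  obtain ⟨C, hC⟩ := cfgVel_bdd m v
  have h1 : IntervalIntegrable (stickyVel m v z i) volume a b := by
    refine (intervalIntegrable_const (c := C)).mono_fun hmeas.aestronglyMeasurable ?_
    refine Eventually.of_forall fun s => ?_
    exact (hC _ _).trans (le_abs_self C)
  refine h1.congr (fun s hs => ?_)
  have hs0 : 0 ≤ s := (le_min ha hb).trans hs.1.le
  simp only [stickyVel_eq_cfg, hz, max_eq_left hs0]

lemma weak_step {N n : ℕ} {m : Fin N → ℝ} {p v : Fin N → EuclideanSpace ℝ (Fin n)}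
    {x : Fin N → ℝ → EuclideanSpace ℝ (Fin n)} (h : IsWeakSolution m p v x) (i : Fin N)
    {a b : ℝ} (ha : 0 ≤ a) (hb : 0 ≤ b) :
    x i b = x i a + ∫ s in a..b, stickyVel m v x i s := by
  rw [h.2.2 i a ha, h.2.2 i b hb, add_assoc, intervalIntegral.integral_add_adjacent_intervals]
  · exact stickyVel_integrable m v x h.1 i _ _ le_rfl ha
  · exact stickyVel_integrable m v x h.1 i _ _ ha hb

lemma sticky_local {N n : ℕ} {m : Fin N → ℝ} {p v : Fin N → EuclideanSpace ℝ (Fin n)}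
    {x : Fin N → ℝ → EuclideanSpace ℝ (Fin n)} (h : IsStickySolution m p v x)
    {t : ℝ} (ht : 0 ≤ t) :
    ∀ᶠ s in 𝓝[>] t, ∀ i, x i s = x i t + (s - t) • cfgVel m v (fun j => x j t) i := by
  have h1 : ∀ᶠ s in 𝓝[>] t, ∀ i j, x i s = x j s ↔ x i t = x j t := by
    refine eventually_all.2 fun i => eventually_all.2 fun j => ?_
    by_cases hij : x i t = x j t
    · filter_upwards [self_mem_nhdsWithin] with s hs
      exact ⟨fun _ => hij, fun _ => h.2 i j t ht hij s (le_of_lt hs)⟩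
    · have hc : ∀ k, Tendsto (x k) (𝓝[>] t) (𝓝 (x k t)) := fun k =>
        ((h.1.1 k) t ht).mono_left (nhdsWithin_mono _ (fun s hs => ht.trans (le_of_lt hs)))
      filter_upwards [((hc i).sub (hc j)).eventually_ne (sub_ne_zero.2 hij)] with s hs
      simp [sub_ne_zero.1 hs, hij]
  obtain ⟨u, hu, hsub⟩ := mem_nhdsGT_iff_exists_Ioo_subset.1 h1
  filter_upwards [Ioo_mem_nhdsGT hu] with s hs i
  rw [weak_step h.1 i ht (ht.trans hs.1.le)]
  congr 1
  rw [← intervalIntegral.integral_const]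
  refine intervalIntegral.integral_congr_ae (Eventually.of_forall fun r hr => ?_)
  rw [uIoc_of_le hs.1.le] at hr
  rw [stickyVel_eq_cfg]
  exact cfgVel_congr _ _ _ _ _ _ fun j => hsub ⟨hr.1, hr.2.trans_lt hs.2⟩ j i

lemma sticky_unique {N n : ℕ} {m : Fin N → ℝ} {p v : Fin N → EuclideanSpace ℝ (Fin n)}
    {x y : Fin N → ℝ → EuclideanSpace ℝ (Fin n)} (hx : IsStickySolution m p v x)
    (hy : IsStickySolution m p v y) (T : ℝ) (hT : 0 ≤ T) : ∀ i, y i T = x i T := by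
  have key : Icc 0 T ⊆ {s | ∀ i, y i s = x i s} := by
    refine IsClosed.Icc_subset_of_forall_mem_nhdsWithin ?_ ?_ ?_
    · have : {s | ∀ i, y i s = x i s} ∩ Icc 0 T =
          Icc 0 T ∩ (fun s => fun i => y i s - x i s) ⁻¹' {0} := by
        ext s
        simp [funext_iff, sub_eq_zero, and_comm]
      rw [this]
      refine ContinuousOn.preimage_isClosed_of_isClosed ?_ isClosed_Icc isClosed_singleton
      refine continuousOn_pi.2 fun i => ?_
      exact ((hy.1.1 i).sub (hx.1.1 i)).mono Icc_subset_Ici_self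
    · intro i
      rw [hy.1.2.1, hx.1.2.1]
    · rintro t ⟨ht, ht0, -⟩
      filter_upwards [sticky_local hx ht0, sticky_local hy ht0] with s h1 h2 i
      have e : (fun j => y j t) = (fun j => x j t) := funext ht
      rw [h1, h2, e, ht i]
  exact key ⟨hT, le_rfl⟩

/-- Free flow up to the first collision. -/
lemma flow_sticky {N n : ℕ} (m : Fin N → ℝ) (v p : Fin N → EuclideanSpace ℝ (Fin n))
    (i j : Fin N) (h : p i = p j) : cfgVel m v p i = cfgVel m v p j :=
  cfgVel_congr _ _ _ _ _ _ fun k => by rw [h]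

lemma sticky_exists {N n : ℕ} (m : Fin N → ℝ) (v : Fin N → EuclideanSpace ℝ (Fin n)) (k : ℕ) :
    ∀ p : Fin N → EuclideanSpace ℝ (Fin n), (Set.range p).ncard ≤ k →
      ∃ x, IsStickySolution m p v x := by
  induction k using Nat.strong_induction_on with
  | _ k ih =>
  intro p hp
  set q : Fin N → ℝ → EuclideanSpace ℝ (Fin n) := fun i t => p i + t • cfgVel m v p i with hq
  have hqc : ∀ i, Continuous (q i) := fun i => by simp only [hq]; fun_prop
  have hq0 : ∀ i, q i 0 = p i := fun i => by simp [hq]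
  have hqs : ∀ i j, p i = p j → ∀ t, q i t = q j t := fun i j h t => by
    simp only [hq, h, flow_sticky m v p i j h]
  have hfree : ∀ t, 0 ≤ t → (∀ s, 0 ≤ s → s < t → ∀ i j, q i s = q j s → p i = p j) →
      ∀ x : Fin N → ℝ → EuclideanSpace ℝ (Fin n), (∀ s, s < t → ∀ i, x i s = q i s) →
      ∀ i, q i t = p i + ∫ s in (0:ℝ)..t, stickyVel m v x i s := by
    intro t ht hno x hxq i
    simp only [hq]
    congr 1
    have : t • cfgVel m v p i = ∫ s in (0:ℝ)..t, cfgVel m v p i := by simp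
    rw [this]
    refine intervalIntegral.integral_congr_ae ?_
    have hne : ∀ᵐ s : ℝ, s ≠ t := by simp [ae_iff]
    filter_upwards [hne] with s hst hs
    rw [uIoc_of_le ht] at hs
    have hlt := lt_of_le_of_ne hs.2 hst
    rw [stickyVel_eq_cfg]
    refine cfgVel_congr _ _ _ _ _ _ fun j => ?_
    rw [hxq s hlt, hxq s hlt]
    exact ⟨fun h => hqs _ _ h s, fun h => hno s hs.1.le hlt _ _ h⟩
  by_cases hcol : ∃ t, 0 ≤ t ∧ ∃ i j, p i ≠ p j ∧ q i t = q j t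
  swap
  · have hno : ∀ s, 0 ≤ s → ∀ i j, q i s = q j s → p i = p j := by
      intro s hs i j h
      by_contra hne
      exact hcol ⟨s, hs, i, j, hne, h⟩
    exact ⟨q, ⟨fun i => (hqc i).continuousOn, hq0, fun i t ht =>
      hfree t ht (fun s hs _ => hno s hs) q (fun _ _ _ => rfl) i⟩,
      fun i j t ht h s hs => hqs i j (hno t ht i j h) s⟩
  set T : Set ℝ := {t | 0 ≤ t ∧ ∃ i j, p i ≠ p j ∧ q i t = q j t} with hTdef
  have hTc : IsClosed T := by
    have : T = Ici 0 ∩ ⋃ i, ⋃ j, {t | p i ≠ p j ∧ q i t = q j t} := by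
      ext t; simp [hTdef]
    rw [this]
    refine isClosed_Ici.inter (isClosed_iUnion_of_finite fun i => isClosed_iUnion_of_finite
      fun j => ?_)
    exact isClosed_const.and (isClosed_eq (hqc i) (hqc j))
  have hTb : BddBelow T := ⟨0, fun t ht => ht.1⟩
  obtain ⟨hτ0, i₀, j₀, hij, hijτ⟩ := hTc.csInf_mem hcol hTb
  set τ := sInf T with hτ
  have hno : ∀ s, 0 ≤ s → s < τ → ∀ i j, q i s = q j s → p i = p j := by
    intro s hs hsτ i j h
    by_contra hne
    exact absurd (csInf_le hTb ⟨hs, i, j, hne, h⟩) (not_le.2 hsτ)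
  have hcard : (Set.range fun i => q i τ).ncard < (Set.range p).ncard := by
    classical
    -- the map p i ↦ q i τ is well-defined, surjective, not injective
    let f : Set.range p → EuclideanSpace ℝ (Fin n) := fun a => q a.2.choose τ
    have hf : ∀ i, f ⟨p i, i, rfl⟩ = q i τ := fun i =>
      hqs _ _ (Exists.choose_spec (⟨i, rfl⟩ : ∃ y, p y = p i)) τ
    have hrange : (Set.range fun i => q i τ) = Set.range f := by
      ext a; constructor
      · rintro ⟨i, rfl⟩; exact ⟨_, hf i⟩
      · rintro ⟨⟨_, i, rfl⟩, rfl⟩; exact ⟨i, (hf i).symm⟩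
    rw [hrange]
    have hninj : ¬ Function.Injective f := fun hinj => hij (by
      have := @hinj ⟨p i₀, i₀, rfl⟩ ⟨p j₀, j₀, rfl⟩ (by rw [hf, hf, hijτ])
      exact congrArg Subtype.val this)
    rw [← Set.image_univ]
    have hle : (f '' univ).ncard ≤ (univ : Set (Set.range p)).ncard := Set.ncard_image_le
    rw [Set.ncard_univ, Nat.card_coe_set_eq] at hle
    refine lt_of_le_of_ne hle fun he => hninj ?_
    rw [← Set.injOn_univ]
    refine Set.injOn_of_ncard_image_eq ?_
    rw [he, Set.ncard_univ, Nat.card_coe_set_eq]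
  obtain ⟨y, hy⟩ := ih _ (hcard.trans_le hp) (fun i => q i τ) le_rfl
  set x : Fin N → ℝ → EuclideanSpace ℝ (Fin n) :=
    fun i t => if t ≤ τ then q i t else y i (t - τ) with hxdef
  have hxl : ∀ s, s ≤ τ → ∀ i, x i s = q i s := fun s hs i => by simp [hxdef, hs]
  have hxr : ∀ s, τ ≤ s → ∀ i, x i s = y i (s - τ) := by
    intro s hs i
    rcases hs.eq_or_lt with rfl | hs
    · simp [hxdef, hy.1.2.1]
    · simp [hxdef, not_le.2 hs]
  have hxc : ∀ i, ContinuousOn (x i) (Ici 0) := by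
    intro i
    have h1 : ContinuousOn (x i) (Icc 0 τ) :=
      (hqc i).continuousOn.congr fun s hs => hxl s hs.2 i
    have h2 : ContinuousOn (x i) (Ici τ) := by
      have : ContinuousOn (fun s => y i (s - τ)) (Ici τ) :=
        (hy.1.1 i).comp (by fun_prop) (fun s hs => by simpa using hs)
      exact this.congr fun s hs => hxr s hs i
    rw [← Icc_union_Ici_eq_Ici hτ0]
    exact h1.union_of_isClosed h2 isClosed_Icc isClosed_Ici
  refine ⟨x, ⟨hxc, fun i => by rw [hxl 0 hτ0, hq0], fun i t ht => ?_⟩, fun i j t₀ ht₀ h t ht => ?_⟩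
  · rcases le_total t τ with htτ | htτ
    · rw [hxl t htτ]
      exact hfree t ht (fun s hs hst => hno s hs (hst.trans_le htτ)) x
        (fun s hs => hxl s (hs.le.trans htτ)) i
    · rw [← intervalIntegral.integral_add_adjacent_intervals
        (stickyVel_integrable m v x hxc i 0 τ le_rfl hτ0)
        (stickyVel_integrable m v x hxc i τ t hτ0 ht), ← add_assoc,
        ← hfree τ hτ0 hno x (fun s hs => hxl s hs.le) i, hxr t htτ,
        hy.1.2.2 i (t - τ) (sub_nonneg.2 htτ)]
      congr 1
      have := intervalIntegral.integral_comp_sub_right (a := τ) (b := t)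
        (fun s => stickyVel m v y i s) τ
      rw [sub_self] at this
      rw [← this]
      refine intervalIntegral.integral_congr fun s hs => ?_
      rw [uIcc_of_le htτ] at hs
      simp only [stickyVel_eq_cfg, hxr s hs.1]
  · have hlate : ∀ t₀, τ ≤ t₀ → x i t₀ = x j t₀ → ∀ t, t₀ ≤ t → x i t = x j t := by
      intro t₀ h0 h t ht
      rw [hxr t₀ h0, hxr t₀ h0] at h
      rw [hxr t (h0.trans ht), hxr t (h0.trans ht)]
      exact hy.2 i j _ (sub_nonneg.2 h0) h _ (by linarith)
    rcases le_or_gt τ t₀ with h0 | h0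
    · exact hlate t₀ h0 h t ht
    · rw [hxl t₀ h0.le, hxl t₀ h0.le] at h
      have hpij := hno t₀ ht₀ h0 i j h
      rcases le_total t τ with htτ | htτ
      · rw [hxl t htτ, hxl t htτ, hqs i j hpij]
      · exact hlate τ le_rfl (by rw [hxl τ le_rfl, hxl τ le_rfl, hqs i j hpij]) t htτ

/-- Remark 1: for finitely many particles, the sticky particle system has a unique global
sticky solution, for any masses, initial positions and initial velocities. -/
theorem finite_sticky_particles_exists_unique (n N : ℕ) (hN : 1 ≤ N)
    (m : Fin N → ℝ) (hm : ∀ i, 0 < m i)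
    (xInit vInit : Fin N → EuclideanSpace ℝ (Fin n)) :
    ∃ x : Fin N → ℝ → EuclideanSpace ℝ (Fin n), IsStickySolution m xInit vInit x ∧
      ∀ y : Fin N → ℝ → EuclideanSpace ℝ (Fin n), IsStickySolution m xInit vInit y →
        ∀ i, ∀ t : ℝ, 0 ≤ t → y i t = x i t := by
  obtain ⟨x, hx⟩ := sticky_exists m vInit _ xInit le_rfl
  exact ⟨x, hx, fun y hy i t ht => sticky_unique hx hy t ht i⟩
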